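/- arXiv:1005.4067 — 4 statements merged into one kernel-verified Lean document; each statement's English description precedes it below -/
import Mathlib

section
/- Let s₁, s₂, s₃, s₄ ∈ ℝ³ be noncoplanar landmarks, let t₀ < t_f be real numbers, let u : ℝ → ℝ³ be continuous, and let r₁, r₂, r₃, r₄ : ℝ → ℝ be continuous with rᵢ(t) > 0 for all t ∈ [t₀, t_f] and i = 1,…,4. For k = 1, 2 let (x₁ᵏ, x₂ᵏ, x₃ᵏ : ℝ → ℝ³; ρ₁ᵏ, ρ₂ᵏ, ρ₃ᵏ, ρ₄ᵏ, ξ₄ᵏ, ξ₅ᵏ, ξ₆ᵏ, ξ₇ᵏ : ℝ → ℝ) satisfy, at every t ∈ [t₀, t_f], the differential equations (x₁ᵏ)′ = x₂ᵏ, (x₂ᵏ)′ = x₃ᵏ + u, (x₃ᵏ)′ = 0, (ρᵢᵏ)′(t) = (−⟨sᵢ, x₂ᵏ(t)⟩ + ξ₄ᵏ(t))/rᵢ(t) for i = 1,…,4, (ξ₄ᵏ)′(t) = ⟨u(t), x₁ᵏ(t)⟩ + ξ₅ᵏ(t), (ξ₅ᵏ)′(t) = 2⟨u(t), x₂ᵏ(t)⟩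 + 3ξ₆ᵏ(t), (ξ₆ᵏ)′(t) = ⟨u(t), x₃ᵏ(t)⟩ + ξ₇ᵏ(t), and (ξ₇ᵏ)′(t) = 0. Suppose the two solutions produce the same outputs on [t₀, t_f]: ρᵢ¹(t) = ρᵢ²(t) for i = 1,…,4, and 2⟨sᵢ − sⱼ, x₁¹(t)⟩/(rᵢ(t) + rⱼ(t)) + ρᵢ¹(t) − ρⱼ¹(t) = 2⟨sᵢ − sⱼ, x₁²(t)⟩/(rᵢ(t) + rⱼ(t)) + ρᵢ²(t) − ρⱼ²(t) for all 1 ≤ i < j ≤ 4 and all t ∈ [t₀, t_f]. Then the full states of the two solutions coincide at t₀: x₁¹(t₀) = x₁²(t₀), x₂¹(t₀) = x₂²(t₀), x₃¹(t₀) = x₃²(t₀), ρᵢ¹(t₀) = ρᵢ²(t₀) for i = 1,…,4, and ξₖ¹(t₀) = ξₖ²(t₀) for k = 4,…,7. -/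
open scoped RealInnerProductSpace

/-- Two functions that agree on a nondegenerate compact interval have the same derivatives there. -/
theorem eqOn_Icc_of_hasDerivAt_of_eqOn {E : Type*} [NormedAddCommGroup E] [NormedSpace ℝ E]
    {a b : ℝ} (hab : a < b) {f g f' g' : ℝ → E}
    (hf : ∀ t ∈ Set.Icc a b, HasDerivAt f (f' t) t)
    (hg : ∀ t ∈ Set.Icc a b, HasDerivAt g (g' t) t)
    (hfg : ∀ t ∈ Set.Icc a b, f t = g t) :
    ∀ t ∈ Set.Icc a b, f' t = g' t := fun t ht =>
  (uniqueDiffOn_Icc hab t ht).eq_deriv _ (hf t ht).hasDerivWithinAt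
    ((hg t ht).hasDerivWithinAt.congr hfg (hfg t ht))

/-- A vector orthogonal to all edges at a vertex of a full-dimensional simplex vanishes. -/
theorem AffineIndependent.eq_zero_of_inner_sub_eq_zero {ι E : Type*} [Fintype ι]
    [NormedAddCommGroup E] [InnerProductSpace ℝ E] [FiniteDimensional ℝ E] {s : ι → E}
    (hs : AffineIndependent ℝ s) (hcard : Fintype.card ι = Module.finrank ℝ E + 1) (i₀ : ι)
    {v : E} (hv : ∀ i, ⟪s i - s i₀, v⟫ = 0) : v = 0 := by
  have hspan := hs.vectorSpan_eq_top_of_card_eq_finrank_add_one hcard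
  rw [vectorSpan_range_eq_span_range_vsub_right ℝ s i₀] at hspan
  refine ext_inner_left ℝ fun w => ?_
  rw [inner_zero_right]
  have hw : w ∈ Submodule.span ℝ (Set.range fun i => s i -ᵥ s i₀) := hspan ▸ Submodule.mem_top
  induction hw using Submodule.span_induction with
  | mem w hw => obtain ⟨i, rfl⟩ := hw; exact hv i
  | zero => exact inner_zero_left v
  | add x y _ _ hx hy => rw [inner_add_left, hx, hy, add_zero]
  | smul c x _ hx => rw [real_inner_smul_left, hx, mul_zero]

/-- observability of the augmented linear time-varying system derived from the
Long Baseline navigation system.  With four noncoplanar (affinely independent) landmarks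
`s i`, positive continuous range signals `r i`, and continuous input `u`, any two solutions
(indexed by `k : Fin 2`) of the augmented dynamics
`ẋ₁ = x₂`, `ẋ₂ = x₃ + u`, `ẋ₃ = 0`,
`ρ̇ᵢ = (−⟨sᵢ, x₂⟩ + ξ₄)/rᵢ`,
`ξ̇₄ = ⟨u, x₁⟩ + ξ₅`, `ξ̇₅ = 2⟨u, x₂⟩ + 3ξ₆`, `ξ̇₆ = ⟨u, x₃⟩ + ξ₇`, `ξ̇₇ = 0`
that produce the same outputs `ρᵢ` and
`2⟨sᵢ − sⱼ, x₁⟩/(rᵢ + rⱼ) + ρᵢ − ρⱼ` on `[t₀, t_f]` coincide at `t₀` in every state. -/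
theorem stmt0 (s : Fin 4 → EuclideanSpace ℝ (Fin 3)) (hs : AffineIndependent ℝ s)
    (t₀ t_f : ℝ) (ht : t₀ < t_f)
    (u : ℝ → EuclideanSpace ℝ (Fin 3)) (hu : Continuous u)
    (r : Fin 4 → ℝ → ℝ) (hr_cont : ∀ i, Continuous (r i))
    (hr_pos : ∀ (i : Fin 4), ∀ t ∈ Set.Icc t₀ t_f, 0 < r i t)
    (x₁ x₂ x₃ : Fin 2 → ℝ → EuclideanSpace ℝ (Fin 3))
    (ρ : Fin 2 → Fin 4 → ℝ → ℝ)
    (ξ₄ ξ₅ ξ₆ ξ₇ : Fin 2 → ℝ → ℝ)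
    (hx₁ : ∀ (k : Fin 2), ∀ t ∈ Set.Icc t₀ t_f, HasDerivAt (x₁ k) (x₂ k t) t)
    (hx₂ : ∀ (k : Fin 2), ∀ t ∈ Set.Icc t₀ t_f, HasDerivAt (x₂ k) (x₃ k t + u t) t)
    (hx₃ : ∀ (k : Fin 2), ∀ t ∈ Set.Icc t₀ t_f, HasDerivAt (x₃ k) 0 t)
    (hρ : ∀ (k : Fin 2) (i : Fin 4), ∀ t ∈ Set.Icc t₀ t_f,
      HasDerivAt (ρ k i) ((-⟪s i, x₂ k t⟫ + ξ₄ k t) / r i t) t)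
    (hξ₄ : ∀ (k : Fin 2), ∀ t ∈ Set.Icc t₀ t_f,
      HasDerivAt (ξ₄ k) (⟪u t, x₁ k t⟫ + ξ₅ k t) t)
    (hξ₅ : ∀ (k : Fin 2), ∀ t ∈ Set.Icc t₀ t_f,
      HasDerivAt (ξ₅ k) (2 * ⟪u t, x₂ k t⟫ + 3 * ξ₆ k t) t)
    (hξ₆ : ∀ (k : Fin 2), ∀ t ∈ Set.Icc t₀ t_f,
      HasDerivAt (ξ₆ k) (⟪u t, x₃ k t⟫ + ξ₇ k t) t)
    (hξ₇ : ∀ (k : Fin 2), ∀ t ∈ Set.Icc t₀ t_f, HasDerivAt (ξ₇ k) 0 t)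
    (hout₁ : ∀ (i : Fin 4), ∀ t ∈ Set.Icc t₀ t_f, ρ 0 i t = ρ 1 i t)
    (hout₂ : ∀ (i j : Fin 4), i < j → ∀ t ∈ Set.Icc t₀ t_f,
      2 * ⟪s i - s j, x₁ 0 t⟫ / (r i t + r j t) + ρ 0 i t - ρ 0 j t =
      2 * ⟪s i - s j, x₁ 1 t⟫ / (r i t + r j t) + ρ 1 i t - ρ 1 j t) :
    x₁ 0 t₀ = x₁ 1 t₀ ∧ x₂ 0 t₀ = x₂ 1 t₀ ∧ x₃ 0 t₀ = x₃ 1 t₀ ∧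
    (∀ i : Fin 4, ρ 0 i t₀ = ρ 1 i t₀) ∧
    ξ₄ 0 t₀ = ξ₄ 1 t₀ ∧ ξ₅ 0 t₀ = ξ₅ 1 t₀ ∧ ξ₆ 0 t₀ = ξ₆ 1 t₀ ∧ ξ₇ 0 t₀ = ξ₇ 1 t₀ := by
  have ht₀ : t₀ ∈ Set.Icc t₀ t_f := Set.left_mem_Icc.2 ht.le
  have hx₁eq : ∀ t ∈ Set.Icc t₀ t_f, x₁ 0 t = x₁ 1 t := by
    intro t h
    refine sub_eq_zero.1 (hs.eq_zero_of_inner_sub_eq_zero (by simp) 0 fun i => ?_)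
    rcases (Fin.zero_le i).eq_or_lt with rfl | hi
    · simp
    have hr : r 0 t + r i t ≠ 0 := (add_pos (hr_pos 0 t h) (hr_pos i t h)).ne'
    have hout := hout₂ 0 i hi t h
    rw [hout₁ 0 t h, hout₁ i t h, sub_left_inj, add_left_inj, div_left_inj' hr] at hout
    rw [← neg_sub, inner_neg_left, inner_sub_right]
    linarith
  have hx₂eq := eqOn_Icc_of_hasDerivAt_of_eqOn ht (hx₁ 0) (hx₁ 1) hx₁eq
  have hx₃eq : ∀ t ∈ Set.Icc t₀ t_f, x₃ 0 t = x₃ 1 t := fun t h =>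
    add_right_cancel (eqOn_Icc_of_hasDerivAt_of_eqOn ht (hx₂ 0) (hx₂ 1) hx₂eq t h)
  have hξ₄eq : ∀ t ∈ Set.Icc t₀ t_f, ξ₄ 0 t = ξ₄ 1 t := by
    intro t h
    have hd := eqOn_Icc_of_hasDerivAt_of_eqOn ht (hρ 0 0) (hρ 1 0) (hout₁ 0) t h
    rw [div_left_inj' (hr_pos 0 t h).ne', hx₂eq t h] at hd
    exact add_left_cancel hd
  have hξ₅eq : ∀ t ∈ Set.Icc t₀ t_f, ξ₅ 0 t = ξ₅ 1 t := by
    intro t h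
    have hd := eqOn_Icc_of_hasDerivAt_of_eqOn ht (hξ₄ 0) (hξ₄ 1) hξ₄eq t h
    rw [hx₁eq t h] at hd
    exact add_left_cancel hd
  have hξ₆eq : ∀ t ∈ Set.Icc t₀ t_f, ξ₆ 0 t = ξ₆ 1 t := by
    intro t h
    have hd := eqOn_Icc_of_hasDerivAt_of_eqOn ht (hξ₅ 0) (hξ₅ 1) hξ₅eq t h
    rw [hx₂eq t h] at hd
    linarith
  have hξ₇eq : ∀ t ∈ Set.Icc t₀ t_f, ξ₇ 0 t = ξ₇ 1 t := by
    intro t h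
    have hd := eqOn_Icc_of_hasDerivAt_of_eqOn ht (hξ₆ 0) (hξ₆ 1) hξ₆eq t h
    rw [hx₃eq t h] at hd
    exact add_left_cancel hd
  exact ⟨hx₁eq t₀ ht₀, hx₂eq t₀ ht₀, hx₃eq t₀ ht₀, fun i => hout₁ i t₀ ht₀, hξ₄eq t₀ ht₀,
    hξ₅eq t₀ ht₀, hξ₆eq t₀ ht₀, hξ₇eq t₀ ht₀⟩
end

section
/- Let s₁, s₂, s₃, s₄ ∈ ℝ³ be noncoplanar landmarks, let t₀ < t_f be real numbers, and let u : ℝ → ℝ³ be continuous. For initial data (p₀, v₀, g₀) ∈ ℝ³ × ℝ³ × ℝ³ define the trajectory x(t) = p₀ + (t − t₀)·v₀ + ((t − t₀)²/2)·g₀ + u^[2](t, t₀), where u^[2](t, t₀) := ∫_{t₀}^{t} ∫_{t₀}^{σ₁} u(σ₂) dσ₂ dσ₁. If (p₀, v₀, g₀) and (p₀′, v₀′, g₀′) are two initial triples whose trajectories x and x′ satisfy ‖x(t) − sᵢ‖ = ‖x′(t) − sᵢ‖ for all i = 1,…,4 and all t ∈ [t₀, t_f], then p₀ = p₀′, v₀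 = v₀′, and g₀ = g₀′. In other words, the initial state of the nonlinear system ẋ₁ = x₂, ẋ₂ = x₃ + u, ẋ₃ = 0 with range outputs rᵢ(t) = ‖sᵢ − x₁(t)‖ is uniquely determined by its input and output on [t₀, t_f]. -/
/-- A point is determined by its distances to a family of points that affinely spans the space. -/
theorem eq_of_forall_norm_sub_eq_of_affineSpan_eq_top {ι V : Type*} [NormedAddCommGroup V]
    [InnerProductSpace ℝ V] {s : ι → V} (hs : affineSpan ℝ (Set.range s) = ⊤) {a b : V}
    (h : ∀ i, ‖a - s i‖ = ‖b - s i‖) : a = b := by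
  rw [← AffineSubspace.perpBisector_eq_top, ← top_le_iff, ← hs, affineSpan_le]
  rintro _ ⟨i, rfl⟩
  rw [SetLike.mem_coe, AffineSubspace.mem_perpBisector_iff_dist_eq']
  simpa only [dist_eq_norm] using h i

/-- A vector-valued quadratic polynomial vanishing on `[0, h]` with `h > 0` is zero. -/
theorem eq_zero_of_quadratic_eq_zero {V : Type*} [AddCommGroup V] [Module ℝ V] {a b c : V}
    {h : ℝ} (hh : 0 < h)
    (H : ∀ τ ∈ Set.Icc 0 h, a + τ • b + (τ ^ 2 / 2) • c = 0) : a = 0 ∧ b = 0 ∧ c = 0 := by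
  have ha : a = 0 := by simpa using H 0 ⟨le_rfl, hh.le⟩
  subst ha
  have h₁ := H h ⟨hh.le, le_rfl⟩
  have h₂ := H (h / 2) ⟨by positivity, by linarith⟩
  have hc : (h ^ 2 / 4) • c = 0 :=
    calc (h ^ 2 / 4) • c = ((0 : V) + h • b + (h ^ 2 / 2) • c)
          - (2 : ℝ) • ((0 : V) + (h / 2) • b + ((h / 2) ^ 2 / 2) • c) := by module
      _ = 0 := by rw [h₁, h₂, smul_zero, sub_zero]
  have hc : c = 0 := (smul_eq_zero.mp hc).resolve_left (by positivity)
  subst hc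
  have hb : h • b = 0 := by simpa using h₁
  exact ⟨rfl, (smul_eq_zero.mp hb).resolve_left hh.ne', rfl⟩

/-- observability of the transformed nonlinear navigation system.  With four
noncoplanar (affinely independent) landmarks, the trajectory
`x(t) = p₀ + (t − t₀)v₀ + ((t − t₀)²/2)g₀ + u^[2](t, t₀)` is uniquely determined by the
ranges `‖x(t) − sᵢ‖`, `i = 1,…,4`, on `[t₀, t_f]`: two initial triples producing the same
ranges coincide. -/
theorem stmt1 (s : Fin 4 → EuclideanSpace ℝ (Fin 3)) (hs : AffineIndependent ℝ s)
    (t₀ t_f : ℝ) (ht : t₀ < t_f)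
    (u : ℝ → EuclideanSpace ℝ (Fin 3)) (hu : Continuous u)
    (p₀ v₀ g₀ p₀' v₀' g₀' : EuclideanSpace ℝ (Fin 3))
    (x x' : ℝ → EuclideanSpace ℝ (Fin 3))
    (hx : ∀ t, x t = p₀ + (t - t₀) • v₀ + ((t - t₀) ^ 2 / 2) • g₀
        + ∫ σ₁ in t₀..t, ∫ σ₂ in t₀..σ₁, u σ₂)
    (hx' : ∀ t, x' t = p₀' + (t - t₀) • v₀' + ((t - t₀) ^ 2 / 2) • g₀'
        + ∫ σ₁ in t₀..t, ∫ σ₂ in t₀..σ₁, u σ₂)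
    (hout : ∀ i : Fin 4, ∀ t ∈ Set.Icc t₀ t_f, ‖x t - s i‖ = ‖x' t - s i‖) :
    p₀ = p₀' ∧ v₀ = v₀' ∧ g₀ = g₀' := by
  have hspan : affineSpan ℝ (Set.range s) = ⊤ := by
    rw [hs.affineSpan_eq_top_iff_card_eq_finrank_add_one]
    simp
  have key := eq_zero_of_quadratic_eq_zero (a := p₀ - p₀') (b := v₀ - v₀') (c := g₀ - g₀')
    (sub_pos.mpr ht) fun τ hτ => by
      have h := eq_of_forall_norm_sub_eq_of_affineSpan_eq_top hspan fun i =>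
        hout i (t₀ + τ) ⟨by linarith [hτ.1], by linarith [hτ.2]⟩
      rw [hx, hx', add_left_inj, add_sub_cancel_left] at h
      rw [← sub_eq_zero] at h
      rw [← h]
      module
  simpa only [sub_eq_zero] using key
end

section
/- Let s₁, s₂, s₃, s₄ ∈ ℝ³ be noncoplanar landmarks, let t₀ < t_f be real numbers, let ω, a : ℝ → ℝ³ be continuous, and let R : ℝ → Matrix (Fin 3) (Fin 3) ℝ be differentiable with R′(t) = R(t)·S(ω(t)) for all t ∈ [t₀, t_f], and with R(t₀) an orthogonal matrix. Suppose (p, v, g) and (p̃, ṽ, g̃), each a triple of functions ℝ → ℝ³, both satisfy at every t ∈ [t₀, t_f] the kinematic equations p′(t) = R(t)·v(t), v′(t) = a(t) − ω(t) × v(t) + g(t), g′(t) = −ω(t) × g(t) (and the same equations with tildes). If ‖p(t) − sᵢ‖ = ‖p̃(t) − sᵢ‖ for all i = 1,…,4 and all t ∈ [t₀, t_f], then p(t₀) = p̃(t₀), v(t₀) = ṽ(t₀), and g(t₀) = g̃(t₀). -/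
open scoped Matrix

attribute [local instance] Matrix.normedAddCommGroup Matrix.normedSpace

/-- Matrix-vector multiplication on Euclidean 3-space. -/
noncomputable def mulVec3 (M : Matrix (Fin 3) (Fin 3) ℝ) (x : EuclideanSpace ℝ (Fin 3)) :
    EuclideanSpace ℝ (Fin 3) :=
  (EuclideanSpace.equiv (Fin 3) ℝ).symm (M.mulVec (EuclideanSpace.equiv (Fin 3) ℝ x))

/-- The cross product on Euclidean 3-space. -/
noncomputable def cross3 (a b : EuclideanSpace ℝ (Fin 3)) : EuclideanSpace ℝ (Fin 3) :=
  (EuclideanSpace.equiv (Fin 3) ℝ).symm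
    (crossProduct (EuclideanSpace.equiv (Fin 3) ℝ a) (EuclideanSpace.equiv (Fin 3) ℝ b))

theorem HasDerivAt.eq_of_eqOn_Icc {E : Type*} [NormedAddCommGroup E] [NormedSpace ℝ E]
    {f g : ℝ → E} {f' g' : E} {a b t : ℝ} (hab : a < b) (hfg : Set.EqOn f g (Set.Icc a b))
    (ht : t ∈ Set.Icc a b) (hf : HasDerivAt f f' t) (hg : HasDerivAt g g' t) : f' = g' :=
  (uniqueDiffOn_Icc hab t ht).eq_deriv _ hf.hasDerivWithinAt
    (hg.hasDerivWithinAt.congr hfg (hfg ht))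

theorem mulVec3_injective {M : Matrix (Fin 3) (Fin 3) ℝ} (hM : M.det ≠ 0) :
    Function.Injective (mulVec3 M) := by
  intro x y h
  exact (EuclideanSpace.equiv (Fin 3) ℝ).injective
    (Matrix.mulVec_injective_of_isUnit ((Matrix.isUnit_iff_isUnit_det M).2 hM.isUnit)
      ((EuclideanSpace.equiv (Fin 3) ℝ).symm.injective h))

/-- A point of a Euclidean space is determined by its distances to the vertices of a
nondegenerate simplex of full dimension. -/
theorem AffineIndependent.eq_of_norm_sub_eq {E : Type*} [NormedAddCommGroup E]
    [InnerProductSpace ℝ E] [FiniteDimensional ℝ E] {ι : Type*} [Fintype ι] {s : ι → E}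
    (hs : AffineIndependent ℝ s) (hcard : Fintype.card ι = Module.finrank ℝ E + 1) {x y : E}
    (h : ∀ i, ‖x - s i‖ = ‖y - s i‖) : x = y := by
  have hspan : affineSpan ℝ (Set.range s) = ⊤ :=
    hs.affineSpan_eq_top_iff_card_eq_finrank_add_one.2 hcard
  have hle : affineSpan ℝ (Set.range s) ≤ AffineSubspace.perpBisector x y := by
    rw [affineSpan_le]
    rintro _ ⟨i, rfl⟩
    rw [SetLike.mem_coe, AffineSubspace.mem_perpBisector_iff_dist_eq', dist_eq_norm, dist_eq_norm]
    exact h i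
  rw [hspan, top_le_iff, AffineSubspace.perpBisector_eq_top] at hle
  exact hle

/-- observability of the original nonlinear navigation system.  With four
noncoplanar (affinely independent) landmarks, two solutions `(p, v, g)` and `(p̃, ṽ, g̃)` of
the vehicle kinematics `ṗ = Rv`, `v̇ = a − ω × v + g`, `ġ = −ω × g` (attitude `R` with
`Ṙ = R S(ω)`, `R(t₀)` orthogonal) producing the same ranges to the landmarks on `[t₀, t_f]`
have the same initial position, velocity, and gravity vector. -/
theorem stmt2 (s : Fin 4 → EuclideanSpace ℝ (Fin 3)) (hs : AffineIndependent ℝ s)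
    (t₀ t_f : ℝ) (ht : t₀ < t_f)
    (ω a : ℝ → EuclideanSpace ℝ (Fin 3)) (hω : Continuous ω) (ha : Continuous a)
    (S : EuclideanSpace ℝ (Fin 3) → Matrix (Fin 3) (Fin 3) ℝ)
    (hS : ∀ w x, mulVec3 (S w) x = cross3 w x)
    (R : ℝ → Matrix (Fin 3) (Fin 3) ℝ)
    (hR : ∀ t ∈ Set.Icc t₀ t_f, HasDerivAt R (R t * S (ω t)) t)
    (hR₀ : (R t₀)ᵀ * R t₀ = 1)
    (p v g p' v' g' : ℝ → EuclideanSpace ℝ (Fin 3))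
    (hp : ∀ t ∈ Set.Icc t₀ t_f, HasDerivAt p (mulVec3 (R t) (v t)) t)
    (hv : ∀ t ∈ Set.Icc t₀ t_f, HasDerivAt v (a t - cross3 (ω t) (v t) + g t) t)
    (hg : ∀ t ∈ Set.Icc t₀ t_f, HasDerivAt g (-cross3 (ω t) (g t)) t)
    (hp' : ∀ t ∈ Set.Icc t₀ t_f, HasDerivAt p' (mulVec3 (R t) (v' t)) t)
    (hv' : ∀ t ∈ Set.Icc t₀ t_f, HasDerivAt v' (a t - cross3 (ω t) (v' t) + g' t) t)
    (hg' : ∀ t ∈ Set.Icc t₀ t_f, HasDerivAt g' (-cross3 (ω t) (g' t)) t)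
    (hout : ∀ i : Fin 4, ∀ t ∈ Set.Icc t₀ t_f, ‖p t - s i‖ = ‖p' t - s i‖) :
    p t₀ = p' t₀ ∧ v t₀ = v' t₀ ∧ g t₀ = g' t₀ := by
  have hpp : Set.EqOn p p' (Set.Icc t₀ t_f) := fun t htm =>
    hs.eq_of_norm_sub_eq (by simp) fun i => hout i t htm
  have h₀ : t₀ ∈ Set.Icc t₀ t_f := Set.left_mem_Icc.2 ht.le
  have hdet₀ : (R t₀).det ≠ 0 := by
    intro h
    have := congrArg Matrix.det hR₀
    simp [h] at this
  have hdet : ∀ᶠ t in nhds t₀, (R t).det ≠ 0 :=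
    ((continuous_id.matrix_det.continuousAt).comp (hR t₀ h₀).continuousAt).eventually_ne hdet₀
  obtain ⟨ε, hε, hball⟩ := Metric.eventually_nhds_iff.1 hdet
  obtain ⟨b, hb₀, hb⟩ := exists_between (lt_min ht (lt_add_of_pos_right t₀ hε))
  obtain ⟨hbf, hbε⟩ := lt_min_iff.1 hb
  have hvv : Set.EqOn v v' (Set.Icc t₀ b) := by
    intro t htb
    have htm : t ∈ Set.Icc t₀ t_f := ⟨htb.1, htb.2.trans hbf.le⟩
    refine mulVec3_injective (hball ?_) ((hp t htm).eq_of_eqOn_Icc ht hpp htm (hp' t htm))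
    rw [Real.dist_eq, abs_lt]
    constructor <;> linarith [htb.1, htb.2]
  have hb₀m : t₀ ∈ Set.Icc t₀ b := Set.left_mem_Icc.2 hb₀.le
  refine ⟨hpp h₀, hvv hb₀m, ?_⟩
  have hd := (hv t₀ h₀).eq_of_eqOn_Icc hb₀ hvv hb₀m (hv' t₀ h₀)
  rw [hvv hb₀m] at hd
  exact add_left_cancel hd
end

section
/- Let ω, a : ℝ → ℝ³, let R : ℝ → Matrix (Fin 3) (Fin 3) ℝ be differentiable at t with R′(t) = R(t)·S(ω(t)), and let p, v, g : ℝ → ℝ³ satisfy at the point t: p′(t) = R(t)·v(t), v′(t) = a(t) − ω(t) × v(t) + g(t), and g′(t) = −ω(t) × g(t). Define x₁ := p, x₂(t) := R(t)·v(t), and x₃(t) := R(t)·g(t). Then at the point t: x₁′(t) = x₂(t), x₂′(t) = x₃(t) + R(t)·a(t), and x₃′(t) = 0. -/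
attribute [local instance] Matrix.normedAddCommGroup Matrix.normedSpace

theorem mulVec3_add (M : Matrix (Fin 3) (Fin 3) ℝ) (x y : EuclideanSpace ℝ (Fin 3)) :
    mulVec3 M (x + y) = mulVec3 M x + mulVec3 M y := by
  simp [mulVec3, Matrix.mulVec_add]

theorem mulVec3_neg (M : Matrix (Fin 3) (Fin 3) ℝ) (x : EuclideanSpace ℝ (Fin 3)) :
    mulVec3 M (-x) = -mulVec3 M x := by
  simp [mulVec3, Matrix.mulVec_neg]

theorem mulVec3_mul (M N : Matrix (Fin 3) (Fin 3) ℝ) (x : EuclideanSpace ℝ (Fin 3)) :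
    mulVec3 (M * N) x = mulVec3 M (mulVec3 N x) := by
  simp only [mulVec3, ContinuousLinearEquiv.apply_symm_apply, Matrix.mulVec_mulVec]

/-- The product rule for matrix-vector multiplication. -/
theorem HasDerivAt.mulVec3 {R : ℝ → Matrix (Fin 3) (Fin 3) ℝ} {R' : Matrix (Fin 3) (Fin 3) ℝ}
    {v : ℝ → EuclideanSpace ℝ (Fin 3)} {v' : EuclideanSpace ℝ (Fin 3)} {t : ℝ}
    (hR : HasDerivAt R R' t) (hv : HasDerivAt v v' t) :
    HasDerivAt (fun τ => _root_.mulVec3 (R τ) (v τ))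
      (_root_.mulVec3 R' (v t) + _root_.mulVec3 (R t) v') t := by
  have hR_entry : ∀ i j, HasDerivAt (fun τ => R τ i j) (R' i j) t := fun i j =>
    hasDerivAt_pi.1 (hasDerivAt_pi.1 hR i) j
  have hv_entry : ∀ j, HasDerivAt (fun τ => v τ j) (v' j) t := fun j =>
    (EuclideanSpace.proj (𝕜 := ℝ) j).hasFDerivAt.comp_hasDerivAt t hv
  have key : HasDerivAt (fun τ => (R τ).mulVec (v τ).ofLp)
      (R'.mulVec (v t).ofLp + (R t).mulVec v'.ofLp) t := by
    refine hasDerivAt_pi.2 fun i => ?_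
    have h := HasDerivAt.fun_sum (u := Finset.univ)
      fun j _ => (hR_entry i j).mul (hv_entry j)
    simpa [Matrix.mulVec, dotProduct, Finset.sum_add_distrib] using h
  exact (EuclideanSpace.equiv (Fin 3) ℝ).symm.hasFDerivAt.comp_hasDerivAt t key

/-- the Lyapunov state transformation `(x₁, x₂, x₃) = (p, Rv, Rg)` turns the
vehicle kinematics `ṗ = Rv`, `v̇ = a − ω × v + g`, `ġ = −ω × g` (with `Ṙ = R S(ω)`) into
the time-invariant dynamics `ẋ₁ = x₂`, `ẋ₂ = x₃ + Ra`, `ẋ₃ = 0`. -/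
theorem stmt3 (ω a : ℝ → EuclideanSpace ℝ (Fin 3)) (t : ℝ)
    (S : EuclideanSpace ℝ (Fin 3) → Matrix (Fin 3) (Fin 3) ℝ)
    (hS : ∀ w x, mulVec3 (S w) x = cross3 w x)
    (R : ℝ → Matrix (Fin 3) (Fin 3) ℝ)
    (hR : HasDerivAt R (R t * S (ω t)) t)
    (p v g : ℝ → EuclideanSpace ℝ (Fin 3))
    (hp : HasDerivAt p (mulVec3 (R t) (v t)) t)
    (hv : HasDerivAt v (a t - cross3 (ω t) (v t) + g t) t)
    (hg : HasDerivAt g (-cross3 (ω t) (g t)) t)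
    (x₁ x₂ x₃ : ℝ → EuclideanSpace ℝ (Fin 3))
    (hx₁ : x₁ = p)
    (hx₂ : ∀ τ, x₂ τ = mulVec3 (R τ) (v τ))
    (hx₃ : ∀ τ, x₃ τ = mulVec3 (R τ) (g τ)) :
    HasDerivAt x₁ (x₂ t) t ∧
    HasDerivAt x₂ (x₃ t + mulVec3 (R t) (a t)) t ∧
    HasDerivAt x₃ 0 t := by
  subst hx₁
  obtain rfl : x₂ = fun τ => mulVec3 (R τ) (v τ) := funext hx₂
  obtain rfl : x₃ = fun τ => mulVec3 (R τ) (g τ) := funext hx₃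
  refine ⟨hp, ?_, ?_⟩
  · convert hR.mulVec3 hv using 1
    simp only [mulVec3_mul, hS, mulVec3_add, mulVec3_neg, sub_eq_add_neg]
    abel
  · convert hR.mulVec3 hg using 1
    simp only [mulVec3_mul, hS, mulVec3_neg, add_neg_cancel]
end
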